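/- (Ill-posedness: failure of C² flow) Let s₁, s₂ ∈ ℝ and −1 ≤ α < 0. There is no T > 0 and constant C such that ‖∫₀^t W_α(t−t')( W_α(t')φ · ∂_x W_α(t')φ ) dt'‖_{H^{s₁,s₂}} ≤ C ‖φ‖²_{H^{s₁,s₂}} holds for all φ ∈ H^{s₁,s₂}(ℝ²) and all t ∈ [0,T]. Concretely, with \widehat{φ} = γ^{−3/2} 𝟙_{D₁} + γ^{−3/2} N^{−s₁−(3−α)s₂/2} 𝟙_{D₂} (D₁, D₂ as in the resonance construction, γ²N = N^{−ε}, 0 < ε ≪ 1), one has ‖φ‖_{H^{s₁,s₂}} ∼ 1 while the left-hand side is ≳ N^{(1−3ε)/4} → ∞ as N → ∞. -/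

import Mathlib

open MeasureTheory Filter
open scoped ENNReal

noncomputable section

/-- Fourier transform on ℝ². -/
def FT2 (f : ℝ × ℝ → ℂ) : ℝ × ℝ → ℂ := fun p =>
  ∫ q : ℝ × ℝ, Complex.exp (-((2 * Real.pi * (p.1 * q.1 + p.2 * q.2) : ℝ) : ℂ) * Complex.I) * f q

/-- Inverse Fourier transform on ℝ². -/
def IFT2 (f : ℝ × ℝ → ℂ) : ℝ × ℝ → ℂ := fun x =>
  ∫ p : ℝ × ℝ, Complex.exp (((2 * Real.pi * (x.1 * p.1 + x.2 * p.2) : ℝ) : ℂ) * Complex.I) * f p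

/-- Homogeneous fractional derivative in `x`, symbol `|ξ|^s`. -/
def Dx (s : ℝ) (f : ℝ × ℝ → ℂ) : ℝ × ℝ → ℂ :=
  IFT2 fun p => ((|p.1| ^ s : ℝ) : ℂ) * FT2 f p

/-- Fractional derivative in `x` with complex order `β`. -/
def DxC (β : ℂ) (f : ℝ × ℝ → ℂ) : ℝ × ℝ → ℂ :=
  IFT2 fun p => (((|p.1| : ℝ) : ℂ) ^ β) * FT2 f p

/-- Inhomogeneous derivative `J_x^s = (1+|D_x|²)^{s/2}`. -/
def Jx (s : ℝ) (f : ℝ × ℝ → ℂ) : ℝ × ℝ → ℂ :=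
  IFT2 fun p => (((1 + p.1 ^ 2) ^ (s / 2) : ℝ) : ℂ) * FT2 f p

/-- Real-valued version of `J_x^s`. -/
def JxR (s : ℝ) (f : ℝ × ℝ → ℝ) : ℝ × ℝ → ℝ := fun z =>
  (Jx s (fun w => ((f w : ℝ) : ℂ)) z).re

/-- The unitary group `W_α(t)` with symbol `e^{-it(ξ³+sgn(ξ)|ξ|^α η²)}`. -/
def Wgrp (α t : ℝ) (f : ℝ × ℝ → ℂ) : ℝ × ℝ → ℂ :=
  IFT2 fun p =>
    Complex.exp (-Complex.I * (t : ℂ) *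
      ((p.1 ^ 3 + Real.sign p.1 * |p.1| ^ α * p.2 ^ 2 : ℝ) : ℂ)) * FT2 f p

/-- The operator `ℋ D_x^α` (Hilbert transform composed with fractional derivative in `x`). -/
def HDa (α : ℝ) (f : ℝ × ℝ → ℂ) : ℝ × ℝ → ℂ :=
  IFT2 fun p => (-Complex.I) * ((Real.sign p.1 * |p.1| ^ α : ℝ) : ℂ) * FT2 f p

/-- Anisotropic Sobolev norm of `H^{s₁,s₂}(ℝ²)`. -/
def HNorm2 (s₁ s₂ : ℝ) (f : ℝ × ℝ → ℂ) : ℝ :=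
  Real.sqrt (∫ p : ℝ × ℝ, ((1 + p.1 ^ 2) ^ s₁ + (1 + p.2 ^ 2) ^ s₂) * ‖FT2 f p‖ ^ 2)

/-- Membership in the anisotropic Sobolev space `H^{s₁,s₂}(ℝ²)`. -/
def MemH (s₁ s₂ : ℝ) (f : ℝ × ℝ → ℂ) : Prop :=
  Integrable (fun p : ℝ × ℝ => ((1 + p.1 ^ 2) ^ s₁ + (1 + p.2 ^ 2) ^ s₂) * ‖FT2 f p‖ ^ 2) volume

/-- Homogeneous anisotropic Sobolev norm. -/
def HdotNorm (s₁ s₂ : ℝ) (f : ℝ × ℝ → ℂ) : ℝ :=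
  Real.sqrt (∫ p : ℝ × ℝ, (|p.1| ^ (2 * s₁) + |p.2| ^ (2 * s₂)) * ‖FT2 f p‖ ^ 2)

/-- `u` solves `u_t = u_{xxx} - ℋ D_x^α u_{yy} + u u_x` (complex-valued version). -/
def IsSol (α : ℝ) (u : ℝ → ℝ × ℝ → ℂ) : Prop :=
  ∀ t : ℝ, ∀ z : ℝ × ℝ,
    HasDerivAt (fun s => u s z)
      (iteratedDeriv 3 (fun a => u t (a, z.2)) z.1
        - HDa α (fun w => iteratedDeriv 2 (fun b => u t (w.1, b)) w.2) z
        + u t z * deriv (fun a => u t (a, z.2)) z.1) t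

/-- `u` solves `u_t = u_{xxx} - ℋ D_x^α u_{yy} + u u_x` (real-valued version). -/
def IsSolR (α : ℝ) (u : ℝ → ℝ × ℝ → ℝ) : Prop :=
  ∀ t : ℝ, ∀ z : ℝ × ℝ,
    HasDerivAt (fun s => u s z)
      (iteratedDeriv 3 (fun a => u t (a, z.2)) z.1
        - (HDa α (fun w => ((iteratedDeriv 2 (fun b => u t (w.1, b)) w.2 : ℝ) : ℂ)) z).re
        + u t z * deriv (fun a => u t (a, z.2)) z.1) t

/-- `u` solves the equation on the time interval `[0,T]` (real-valued version). -/
def IsSolROn (α T : ℝ) (u : ℝ → ℝ × ℝ → ℝ) : Prop :=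
  ∀ t ∈ Set.Icc (0 : ℝ) T, ∀ z : ℝ × ℝ,
    HasDerivAt (fun s => u s z)
      (iteratedDeriv 3 (fun a => u t (a, z.2)) z.1
        - (HDa α (fun w => ((iteratedDeriv 2 (fun b => u t (w.1, b)) w.2 : ℝ) : ℂ)) z).re
        + u t z * deriv (fun a => u t (a, z.2)) z.1) t

/-- `w` solves the inhomogeneous linear equation `∂_t w = w_{xxx} - ℋ D_x^α w_{yy} + F` on `[0,T]`. -/
def IsSolLin (α T : ℝ) (w F : ℝ → ℝ × ℝ → ℂ) : Prop :=
  ∀ t ∈ Set.Icc (0 : ℝ) T, ∀ z : ℝ × ℝ,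
    HasDerivAt (fun s => w s z)
      (iteratedDeriv 3 (fun a => w t (a, z.2)) z.1
        - HDa α (fun q => iteratedDeriv 2 (fun b => w t (q.1, b)) q.2) z
        + F t z) t

open scoped ContDiff FourierTransform

lemma IFT2_eq_fourierInv (f : ℝ × ℝ → ℂ) (x : WithLp 2 (ℝ × ℝ)) :
    IFT2 f (WithLp.ofLp x) = 𝓕⁻ (fun v : WithLp 2 (ℝ × ℝ) => f (WithLp.ofLp v)) x := by
  rw [Real.fourierInv_eq', IFT2, ← (WithLp.volume_preserving_ofLp ℝ ℝ).integral_comp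
    (WithLp.homeomorphProd 2 ℝ ℝ).measurableEmbedding]
  refine integral_congr_ae (Eventually.of_forall fun v => ?_)
  simp [WithLp.prod_inner_apply]

lemma FT2_eq_fourier (f : ℝ × ℝ → ℂ) (x : WithLp 2 (ℝ × ℝ)) :
    FT2 f (WithLp.ofLp x) = 𝓕 (fun v : WithLp 2 (ℝ × ℝ) => f (WithLp.ofLp v)) x := by
  rw [Real.fourier_eq', FT2, ← (WithLp.volume_preserving_ofLp ℝ ℝ).integral_comp
    (WithLp.homeomorphProd 2 ℝ ℝ).measurableEmbedding]
  refine integral_congr_ae (Eventually.of_forall fun v => ?_)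
  simp [WithLp.prod_inner_apply]

/-- Fourier inversion for test functions. -/
lemma FT2_IFT2 {f : ℝ × ℝ → ℂ} (hf : ContDiff ℝ ∞ f) (hc : HasCompactSupport f) :
    FT2 (IFT2 f) = f := by
  have h1 : ContDiff ℝ ∞ (fun v : WithLp 2 (ℝ × ℝ) => f (WithLp.ofLp v)) :=
    hf.comp (WithLp.prodContinuousLinearEquiv 2 ℝ ℝ ℝ).contDiff
  have h2 : HasCompactSupport (fun v : WithLp 2 (ℝ × ℝ) => f (WithLp.ofLp v)) :=
    hc.comp_homeomorph (WithLp.homeomorphProd 2 ℝ ℝ)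
  let g := h2.toSchwartzMap h1
  have h3 : 𝓕 (𝓕⁻ g) = g := FourierTransform.fourier_fourierInv_eq g
  funext p
  have h4 := congrArg (fun u : SchwartzMap (WithLp 2 (ℝ × ℝ)) ℂ => u (WithLp.toLp 2 p)) h3
  simp only [SchwartzMap.fourier_coe, SchwartzMap.fourierInv_coe] at h4
  rw [show p = WithLp.ofLp (WithLp.toLp 2 p) from rfl, FT2_eq_fourier]
  simp only [IFT2_eq_fourierInv]
  exact h4

lemma hasDerivAt_IFT2 {f : ℝ × ℝ → ℂ} (hf : Continuous f) (hc : HasCompactSupport f)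
    (x y : ℝ) :
    HasDerivAt (fun a => IFT2 f (a, y))
      (IFT2 (fun p => 2 * Real.pi * Complex.I * p.1 * f p) (x, y)) x := by
  have hcont : ∀ a : ℝ, Continuous fun p : ℝ × ℝ =>
      Complex.exp (((2 * Real.pi * (a * p.1 + y * p.2) : ℝ) : ℂ) * Complex.I) * f p := by
    intro a; fun_prop
  have h := hasDerivAt_integral_of_dominated_loc_of_deriv_le (μ := (volume : Measure (ℝ × ℝ)))
    (F := fun a p => Complex.exp (((2 * Real.pi * (a * p.1 + y * p.2) : ℝ) : ℂ) * Complex.I) * f p)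
    (F' := fun a p => Complex.exp (((2 * Real.pi * (a * p.1 + y * p.2) : ℝ) : ℂ) * Complex.I) *
      (2 * Real.pi * Complex.I * p.1 * f p)) (x₀ := x) (s := Set.univ)
    (bound := fun p => ‖2 * Real.pi * Complex.I * p.1 * f p‖) univ_mem
    (Eventually.of_forall fun a => (hcont a).aestronglyMeasurable)
    ((hcont x).integrable_of_hasCompactSupport hc.mul_left)
    (by refine Continuous.aestronglyMeasurable ?_; fun_prop)
    (Eventually.of_forall fun p a _ => by
      rw [norm_mul, Complex.norm_exp_ofReal_mul_I, one_mul])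
    (Continuous.integrable_of_hasCompactSupport (by fun_prop) (hc.mul_left.norm))
    (Eventually.of_forall fun p a _ => by
      have h1 : HasDerivAt (fun a : ℝ => 2 * Real.pi * (a * p.1 + y * p.2))
          (2 * Real.pi * p.1) a := by
        simpa using (((hasDerivAt_id a).mul_const p.1).add_const (y * p.2)).const_mul (2 * Real.pi)
      have h2 := (((h1.ofReal_comp).mul_const Complex.I).cexp).mul_const (f p)
      refine h2.congr_deriv ?_
      push_cast
      ring)
  exact h.2

lemma IFT2_mul_IFT2 {f g : ℝ × ℝ → ℂ} (hf : Integrable f) (hg : Integrable g) (x : ℝ × ℝ) :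
    IFT2 f x * IFT2 g x = IFT2 (fun k => ∫ p, f p * g (k - p)) x := by
  have hchar : Continuous fun p : ℝ × ℝ =>
      Complex.exp (((2 * Real.pi * (x.1 * p.1 + x.2 * p.2) : ℝ) : ℂ) * Complex.I) := by fun_prop
  have key : ∀ {f : ℝ × ℝ → ℂ}, Integrable f → Integrable fun p : ℝ × ℝ =>
      Complex.exp (((2 * Real.pi * (x.1 * p.1 + x.2 * p.2) : ℝ) : ℂ) * Complex.I) * f p := by
    intro f hf
    refine hf.bdd_mul (c := 1) hchar.aestronglyMeasurable (Eventually.of_forall fun p => ?_)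
    rw [Complex.norm_exp_ofReal_mul_I]
  have h := integral_convolution (ContinuousLinearMap.mul ℝ ℂ) (key hf) (key hg)
  rw [ContinuousLinearMap.mul_apply'] at h
  rw [IFT2, IFT2, ← h, IFT2]
  refine integral_congr_ae (Eventually.of_forall fun k => ?_)
  simp only [convolution_def, ContinuousLinearMap.mul_apply']
  rw [← integral_const_mul]
  refine integral_congr_ae (Eventually.of_forall fun p => ?_)
  simp only
  rw [mul_mul_mul_comm, ← Complex.exp_add]
  congr 2
  simp only [Prod.fst_sub, Prod.snd_sub]
  push_cast
  ring
/-- The dispersion relation of the group `Wgrp α`. -/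
def disp (α : ℝ) (p : ℝ × ℝ) : ℝ := p.1 ^ 3 + Real.sign p.1 * |p.1| ^ α * p.2 ^ 2

lemma disp_of_pos (α : ℝ) {p : ℝ × ℝ} (hp : 0 < p.1) :
    disp α p = p.1 ^ 3 + p.1 ^ α * p.2 ^ 2 := by
  rw [disp, Real.sign_of_pos hp, abs_of_pos hp, one_mul]

lemma contDiffAt_disp (α : ℝ) {p : ℝ × ℝ} (hp : 0 < p.1) : ContDiffAt ℝ ∞ (disp α) p := by
  have h : disp α =ᶠ[nhds p] fun p => p.1 ^ 3 + p.1 ^ α * p.2 ^ 2 := by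
    filter_upwards [(isOpen_lt continuous_const continuous_fst).mem_nhds hp] with q hq
    exact disp_of_pos α hq
  refine ContDiffAt.congr_of_eventuallyEq ?_ h
  have h1 : ContDiffAt ℝ ∞ (fun p : ℝ × ℝ => p.1 ^ α) p :=
    contDiffAt_fst.rpow_const_of_ne hp.ne'
  exact (contDiffAt_fst.pow 3).add (h1.mul (contDiffAt_snd.pow 2))

/-- Multiplication by the propagator preserves smoothness away from `ξ ≤ 0`. -/
lemma contDiff_phase_mul {P : Type} [NormedAddCommGroup P] [NormedSpace ℝ P] (α : ℝ)
    {θ : P → ℝ} {κ : P → ℝ × ℝ} {g : P → ℂ} {K : Set (ℝ × ℝ)} (hθ : ContDiff ℝ ∞ θ)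
    (hκ : ContDiff ℝ ∞ κ) (hg : ContDiff ℝ ∞ g) (hK : IsClosed K) (hK0 : ∀ p ∈ K, 0 < p.1)
    (hgK : ∀ q, κ q ∉ K → g q = 0) :
    ContDiff ℝ ∞ fun q => Complex.exp (-Complex.I * (θ q : ℂ) * (disp α (κ q) : ℂ)) * g q := by
  rw [contDiff_iff_contDiffAt]
  intro q
  by_cases hq : κ q ∈ K
  · have h1 : ContDiffAt ℝ ∞ (fun q => disp α (κ q)) q :=
      (contDiffAt_disp α (hK0 _ hq)).comp q hκ.contDiffAt
    have h2 : ContDiffAt ℝ ∞ (fun q => (disp α (κ q) : ℂ)) q :=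
      Complex.ofRealCLM.contDiff.contDiffAt.comp q h1
    have h3 : ContDiffAt ℝ ∞ (fun q => (θ q : ℂ)) q :=
      Complex.ofRealCLM.contDiff.contDiffAt.comp q hθ.contDiffAt
    exact ((contDiffAt_const.mul h3).mul h2).cexp.mul hg.contDiffAt
  · have h : (fun q => Complex.exp (-Complex.I * (θ q : ℂ) * (disp α (κ q) : ℂ)) * g q)
        =ᶠ[nhds q] fun _ => 0 := by
      filter_upwards [(hK.isOpen_compl.preimage hκ.continuous).mem_nhds hq] with r hr
      rw [hgK r hr, mul_zero]
    exact contDiffAt_const.congr_of_eventuallyEq h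

/-- A parametric integral of a smooth function whose support in the integration variable is
contained in a fixed compact set is smooth. -/
lemma contDiff_integral_smul {P G : Type} [NormedAddCommGroup P] [NormedSpace ℝ P]
    [NormedAddCommGroup G] [NormedSpace ℝ G] [MeasurableSpace G] [BorelSpace G]
    {μ : Measure G} {f : G → ℝ} {Φ : P × G → ℂ} {K : Set G} (hf : LocallyIntegrable f μ)
    (hΦ : ContDiff ℝ ∞ Φ) (hK : IsCompact K) (hΦK : ∀ p, ∀ y ∉ K, Φ (p, y) = 0) :
    ContDiff ℝ ∞ fun p => ∫ y, f y • Φ (p, y) ∂μ := by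
  have h := contDiffOn_convolution_right_with_param_comp (n := ⊤) (μ := μ) (𝕜 := ℝ)
    (ContinuousLinearMap.lsmul ℝ ℝ) (s := Set.univ) (v := fun _ : P => (0 : G)) contDiffOn_const
    (f := f) (g := fun p y => Φ (p, -y)) (k := -K) isOpen_univ hK.neg
    (fun p x _ hx => hΦK p _ (by simpa using hx)) hf
    (ContDiff.contDiffOn (hΦ.comp (contDiff_fst.prodMk contDiff_snd.neg)))
  rw [contDiffOn_univ] at h
  convert h using 2 with p
  simp [convolution_def]

lemma contDiff_intervalIntegral {P : Type} [NormedAddCommGroup P] [NormedSpace ℝ P]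
    {Φ : P × ℝ → ℂ} (hΦ : ContDiff ℝ ∞ Φ) {t : ℝ} (ht : 0 ≤ t) :
    ContDiff ℝ ∞ fun p => ∫ s in (0 : ℝ)..t, Φ (p, s) := by
  let χ : ContDiffBump (0 : ℝ) := ⟨t + 1, t + 2, by linarith, by linarith⟩
  have hχ : ContDiff ℝ ∞ fun q : P × ℝ => χ q.2 • Φ q :=
    (χ.contDiff.comp contDiff_snd).smul hΦ
  have h := contDiff_integral_smul (μ := (volume : Measure ℝ))
    (f := (Set.Ioc 0 t).indicator fun _ => (1 : ℝ)) (K := tsupport χ)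
    (((integrable_indicator_iff measurableSet_Ioc).2 (by simp)).locallyIntegrable)
    hχ χ.hasCompactSupport (fun p y hy => by simp [image_eq_zero_of_notMem_tsupport hy])
  convert h using 2 with p
  rw [intervalIntegral.integral_of_le ht, ← integral_indicator measurableSet_Ioc]
  refine integral_congr_ae (Eventually.of_forall fun s => ?_)
  by_cases hs : s ∈ Set.Ioc 0 t
  · have : χ s = 1 := χ.one_of_mem_closedBall (by
      have h1 := hs.1
      have h2 := hs.2
      rw [Metric.mem_closedBall, Real.dist_eq, sub_zero, abs_of_pos h1]
      change s ≤ t + 1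
      linarith)
    simp [hs, this]
  · simp [hs]
open scoped Pointwise

lemma intervalIntegral_IFT2 {G : (ℝ × ℝ) × ℝ → ℂ} (hG : Continuous G) {K : Set (ℝ × ℝ)}
    (hK : IsCompact K) (hGK : ∀ k ∉ K, ∀ s, G (k, s) = 0) {t : ℝ} (ht : 0 ≤ t) (z : ℝ × ℝ) :
    ∫ s in (0 : ℝ)..t, IFT2 (fun k => G (k, s)) z =
      IFT2 (fun k => ∫ s in (0 : ℝ)..t, G (k, s)) z := by
  simp only [IFT2, intervalIntegral.integral_of_le ht, ← integral_const_mul]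
  refine integral_integral_swap ?_
  have hcont : Continuous fun q : ℝ × (ℝ × ℝ) =>
      Complex.exp (((2 * Real.pi * (z.1 * q.2.1 + z.2 * q.2.2) : ℝ) : ℂ) * Complex.I) *
        G (q.2, q.1) := by fun_prop
  have h1 : IntegrableOn (fun q : ℝ × (ℝ × ℝ) =>
      Complex.exp (((2 * Real.pi * (z.1 * q.2.1 + z.2 * q.2.2) : ℝ) : ℂ) * Complex.I) *
        G (q.2, q.1)) (Set.Icc 0 t ×ˢ K) :=
    hcont.continuousOn.integrableOn_compact (isCompact_Icc.prod hK)
  have h2 : IntegrableOn (fun q : ℝ × (ℝ × ℝ) =>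
      Complex.exp (((2 * Real.pi * (z.1 * q.2.1 + z.2 * q.2.2) : ℝ) : ℂ) * Complex.I) *
        G (q.2, q.1)) (Set.Icc 0 t ×ˢ Set.univ) := by
    refine h1.of_forall_sdiff_eq_zero (measurableSet_Icc.prod MeasurableSet.univ) ?_
    rintro ⟨s, k⟩ ⟨⟨hs, -⟩, hk⟩
    have : k ∉ K := fun h => hk ⟨hs, h⟩
    simp [hGK k this s]
  have h3 := h2.mono_set (Set.prod_mono (Set.Ioc_subset_Icc_self (a := 0) (b := t)) subset_rfl)
  rw [IntegrableOn, Measure.volume_eq_prod, ← Measure.prod_restrict, Measure.restrict_univ] at h3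
  exact h3

/-- The profile of the free evolution at time `s`. -/
def freeProfile (α : ℝ) (f : ℝ × ℝ → ℂ) (s : ℝ) (p : ℝ × ℝ) : ℂ :=
  Complex.exp (-Complex.I * (s : ℂ) * (disp α p : ℂ)) * f p

/-- The Fourier transform of `u ∂ₓ u` for the free evolution `u` with profile `f`. -/
def nonlinProfile (α : ℝ) (f : ℝ × ℝ → ℂ) (s : ℝ) (k : ℝ × ℝ) : ℂ :=
  ∫ p, freeProfile α f s p *
    (2 * Real.pi * Complex.I * ((k - p).1 : ℂ) * freeProfile α f s (k - p))

/-- The Fourier transform of the second Picard iterate. -/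
def duhamelProfile (α : ℝ) (f : ℝ × ℝ → ℂ) (t : ℝ) (k : ℝ × ℝ) : ℂ :=
  ∫ s in (0 : ℝ)..t,
    Complex.exp (-Complex.I * ((t - s : ℝ) : ℂ) * (disp α k : ℂ)) * nonlinProfile α f s k

lemma Wgrp_IFT2 {f : ℝ × ℝ → ℂ} (hf : ContDiff ℝ ∞ f) (hc : HasCompactSupport f) (α s : ℝ) :
    Wgrp α s (IFT2 f) = IFT2 (freeProfile α f s) := by
  rw [Wgrp, FT2_IFT2 hf hc]
  rfl

section Profile

variable {α : ℝ} {f : ℝ × ℝ → ℂ} {K : Set (ℝ × ℝ)}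

lemma contDiff_freeProfile_uncurry (hf : ContDiff ℝ ∞ f) (hK : IsCompact K)
    (hK0 : ∀ p ∈ K, 0 < p.1) (hfK : ∀ p ∉ K, f p = 0) :
    ContDiff ℝ ∞ fun q : ℝ × (ℝ × ℝ) => freeProfile α f q.1 q.2 :=
  contDiff_phase_mul α contDiff_fst contDiff_snd (hf.comp contDiff_snd) hK.isClosed hK0
    fun _ hq => hfK _ hq

lemma contDiff_freeProfile (hf : ContDiff ℝ ∞ f) (hK : IsCompact K)
    (hK0 : ∀ p ∈ K, 0 < p.1) (hfK : ∀ p ∉ K, f p = 0) (s : ℝ) :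
    ContDiff ℝ ∞ (freeProfile α f s) :=
  ContDiff.comp (g := fun q : ℝ × (ℝ × ℝ) => freeProfile α f q.1 q.2)
    (f := fun p : ℝ × ℝ => (s, p)) (contDiff_freeProfile_uncurry hf hK hK0 hfK)
    (contDiff_const.prodMk contDiff_id)

lemma hasCompactSupport_freeProfile (hc : HasCompactSupport f) (s : ℝ) :
    HasCompactSupport (freeProfile α f s) :=
  hc.mul_left

lemma freeProfile_eq_zero (hfK : ∀ p ∉ K, f p = 0) (s : ℝ) {p : ℝ × ℝ} (hp : p ∉ K) :
    freeProfile α f s p = 0 := by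
  rw [freeProfile, hfK p hp, mul_zero]

lemma contDiff_nonlinProfile (hf : ContDiff ℝ ∞ f) (hK : IsCompact K)
    (hK0 : ∀ p ∈ K, 0 < p.1) (hfK : ∀ p ∉ K, f p = 0) :
    ContDiff ℝ ∞ fun q : (ℝ × ℝ) × ℝ => nonlinProfile α f q.2 q.1 := by
  have hE := contDiff_freeProfile_uncurry (α := α) hf hK hK0 hfK
  have hΦ : ContDiff ℝ ∞ fun r : ((ℝ × ℝ) × ℝ) × (ℝ × ℝ) => freeProfile α f r.1.2 r.2 *
      (2 * Real.pi * Complex.I * ((r.1.1 - r.2).1 : ℂ) *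
        freeProfile α f r.1.2 (r.1.1 - r.2)) := by
    have h1 : ContDiff ℝ ∞ fun r : ((ℝ × ℝ) × ℝ) × (ℝ × ℝ) => freeProfile α f r.1.2 r.2 :=
      hE.comp (contDiff_fst.snd.prodMk contDiff_snd)
    have h2 : ContDiff ℝ ∞ fun r : ((ℝ × ℝ) × ℝ) × (ℝ × ℝ) =>
        freeProfile α f r.1.2 (r.1.1 - r.2) :=
      hE.comp (contDiff_fst.snd.prodMk (contDiff_fst.fst.sub contDiff_snd))
    have h3 : ContDiff ℝ ∞ fun r : ((ℝ × ℝ) × ℝ) × (ℝ × ℝ) => ((r.1.1 - r.2).1 : ℂ) :=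
      Complex.ofRealCLM.contDiff.comp (contDiff_fst.fst.sub contDiff_snd).fst
    exact h1.mul ((contDiff_const.mul h3).mul h2)
  have h := contDiff_integral_smul (μ := (volume : Measure (ℝ × ℝ))) (f := fun _ => (1 : ℝ))
    (K := K) (locallyIntegrable_const _) hΦ hK
    (fun q p hp => by simp [freeProfile_eq_zero hfK q.2 hp])
  simp only [one_smul] at h
  exact h

lemma nonlinProfile_eq_zero (hfK : ∀ p ∉ K, f p = 0) (s : ℝ) {k : ℝ × ℝ} (hk : k ∉ K + K) :
    nonlinProfile α f s k = 0 := by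
  refine integral_eq_zero_of_ae (Eventually.of_forall fun p => ?_)
  by_cases hp : p ∈ K
  · have : k - p ∉ K := fun h => hk ⟨p, hp, k - p, h, add_sub_cancel p k⟩
    simp [freeProfile_eq_zero hfK s this]
  · simp [freeProfile_eq_zero hfK s hp]

lemma pos_of_mem_add (hK0 : ∀ p ∈ K, 0 < p.1) : ∀ k ∈ K + K, 0 < k.1 := by
  rintro _ ⟨p, hp, q, hq, rfl⟩
  exact add_pos (hK0 p hp) (hK0 q hq)

lemma contDiff_duhamel_integrand (hf : ContDiff ℝ ∞ f) (hK : IsCompact K)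
    (hK0 : ∀ p ∈ K, 0 < p.1) (hfK : ∀ p ∉ K, f p = 0) (t : ℝ) :
    ContDiff ℝ ∞ fun q : (ℝ × ℝ) × ℝ =>
      Complex.exp (-Complex.I * ((t - q.2 : ℝ) : ℂ) * (disp α q.1 : ℂ)) *
        nonlinProfile α f q.2 q.1 :=
  contDiff_phase_mul (K := K + K) α (contDiff_const.sub contDiff_snd) contDiff_fst
    (contDiff_nonlinProfile hf hK hK0 hfK) (hK.add hK).isClosed (pos_of_mem_add hK0)
    fun q hq => nonlinProfile_eq_zero hfK q.2 hq

lemma contDiff_duhamelProfile (hf : ContDiff ℝ ∞ f) (hK : IsCompact K)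
    (hK0 : ∀ p ∈ K, 0 < p.1) (hfK : ∀ p ∉ K, f p = 0) {t : ℝ} (ht : 0 ≤ t) :
    ContDiff ℝ ∞ (duhamelProfile α f t) :=
  contDiff_intervalIntegral (contDiff_duhamel_integrand hf hK hK0 hfK t) ht

lemma hasCompactSupport_duhamelProfile (hK : IsCompact K) (hfK : ∀ p ∉ K, f p = 0) (t : ℝ) :
    HasCompactSupport (duhamelProfile α f t) :=
  HasCompactSupport.intro (hK.add hK) fun k hk => by
    simp [duhamelProfile, nonlinProfile_eq_zero hfK _ hk]

lemma Wgrp_mul_deriv_Wgrp (hf : ContDiff ℝ ∞ f) (hK : IsCompact K)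
    (hK0 : ∀ p ∈ K, 0 < p.1) (hfK : ∀ p ∉ K, f p = 0) (s : ℝ) :
    (fun w => Wgrp α s (IFT2 f) w * deriv (fun a => Wgrp α s (IFT2 f) (a, w.2)) w.1) =
      IFT2 (nonlinProfile α f s) := by
  have hc : HasCompactSupport f := HasCompactSupport.intro hK hfK
  have hE := (contDiff_freeProfile (α := α) hf hK hK0 hfK s).continuous
  have hEc := hasCompactSupport_freeProfile (α := α) hc s
  rw [Wgrp_IFT2 hf hc]
  funext w
  have hg : Integrable fun p : ℝ × ℝ =>
      2 * Real.pi * Complex.I * p.1 * freeProfile α f s p :=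
    Continuous.integrable_of_hasCompactSupport (by fun_prop) hEc.mul_left
  rw [(hasDerivAt_IFT2 hE hEc w.1 w.2).deriv]
  exact IFT2_mul_IFT2 (hE.integrable_of_hasCompactSupport hEc) hg w

/-- The second Picard iterate on the Fourier side. -/
lemma FT2_duhamel (hf : ContDiff ℝ ∞ f) (hK : IsCompact K)
    (hK0 : ∀ p ∈ K, 0 < p.1) (hfK : ∀ p ∉ K, f p = 0) {t : ℝ} (ht : 0 ≤ t) :
    FT2 (fun z => ∫ s in (0 : ℝ)..t, Wgrp α (t - s)
      (fun w => Wgrp α s (IFT2 f) w * deriv (fun a => Wgrp α s (IFT2 f) (a, w.2)) w.1) z) =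
      duhamelProfile α f t := by
  have hN : ∀ s, ContDiff ℝ ∞ (nonlinProfile α f s) := fun s =>
    ContDiff.comp (g := fun q : (ℝ × ℝ) × ℝ => nonlinProfile α f q.2 q.1)
      (f := fun k : ℝ × ℝ => (k, s)) (contDiff_nonlinProfile hf hK hK0 hfK)
      (contDiff_id.prodMk contDiff_const)
  have hNc : ∀ s, HasCompactSupport (nonlinProfile α f s) := fun s =>
    HasCompactSupport.intro (hK.add hK) fun k hk => nonlinProfile_eq_zero hfK s hk
  have key : (fun z => ∫ s in (0 : ℝ)..t, Wgrp α (t - s)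
      (fun w => Wgrp α s (IFT2 f) w * deriv (fun a => Wgrp α s (IFT2 f) (a, w.2)) w.1) z) =
      IFT2 (duhamelProfile α f t) := by
    funext z
    have h := intervalIntegral_IFT2
      (contDiff_duhamel_integrand (α := α) hf hK hK0 hfK t).continuous
      (hK.add hK) (fun k hk s => by simp [nonlinProfile_eq_zero hfK s hk]) ht z
    refine Eq.trans (intervalIntegral.integral_congr fun s _ => ?_) h
    simp only
    rw [Wgrp_mul_deriv_Wgrp hf hK hK0 hfK, Wgrp_IFT2 (hN s) (hNc s)]
    rfl
  rw [key, FT2_IFT2 (contDiff_duhamelProfile hf hK hK0 hfK ht)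
    (hasCompactSupport_duhamelProfile hK hfK t)]

end Profile
set_option maxHeartbeats 400000 in
/-- The resonance function is small on the interaction region. -/
lemma abs_resonance_le {α N γ h d₀ a b c d : ℝ} (hα1 : -1 ≤ α) (hα2 : α < 0) (hN : 1 ≤ N)
    (hγ0 : 0 < γ) (hγ1 : γ ≤ 1) (hγN : γ ^ 2 * N ≤ 1 / 1000) (hh0 : 0 ≤ h) (hd₀ : 0 ≤ d₀)
    (hd₀N : -α * d₀ ^ 2 = 3 * N ^ (3 - α)) (h1 : h * (N ^ α * d₀) ≤ 1 / 1000)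
    (h2 : h ^ 2 ≤ γ * (1 / 1000)) (ha1 : γ ≤ a) (ha2 : a ≤ 3 * γ) (hb : |b| ≤ h) (hc1 : N ≤ c)
    (hc2 : c ≤ N + 2 * γ) (hd : |d - d₀| ≤ h) :
    |disp α (a, b) + disp α (c, d) - disp α (a + c, b + d)| ≤ 1 := by
  have ha0 : 0 < a := by linarith
  have hN0 : 0 < N := by linarith
  have hc0 : 0 < c := by linarith
  rw [disp_of_pos α (p := (a, b)) ha0, disp_of_pos α (p := (c, d)) hc0,
    disp_of_pos α (p := (a + c, b + d)) (add_pos ha0 hc0)]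
  dsimp only
  obtain ⟨θ, ⟨hθ1, hθ2⟩, hθ⟩ := exists_hasDerivAt_eq_slope (fun x : ℝ => x ^ α)
    (fun x => α * x ^ (α - 1)) (a := c) (b := a + c) (by linarith)
    (fun x hx => (Real.continuousAt_rpow_const x α
      (Or.inl (by have := hx.1; intro h; linarith))).continuousWithinAt)
    (fun x hx => Real.hasDerivAt_rpow_const (Or.inl (by have := hx.1; intro h; linarith)))
  have hθ0 : 0 < θ := by linarith
  have hslope : c ^ α - (a + c) ^ α = a * (-α * θ ^ (α - 1)) := by
    rw [add_sub_cancel_right, eq_div_iff ha0.ne'] at hθ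
    linarith
  -- the slope compared with its value at `N`
  have hR1 : θ ^ (α - 1) * N ^ (1 - α) ≤ 1 := by
    have : θ ^ (α - 1) ≤ N ^ (α - 1) :=
      Real.rpow_le_rpow_of_nonpos hN0 (by linarith) (by linarith)
    calc θ ^ (α - 1) * N ^ (1 - α) ≤ N ^ (α - 1) * N ^ (1 - α) := by gcongr
      _ = 1 := by rw [← Real.rpow_add hN0]; norm_num
  have hR2 : 1 - 2 * (θ - N) / N ≤ θ ^ (α - 1) * N ^ (1 - α) := by
    have e : θ ^ (α - 1) * N ^ (1 - α) = (N / θ) ^ (1 - α) := by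
      rw [Real.div_rpow hN0.le hθ0.le, show α - 1 = -(1 - α) by ring, Real.rpow_neg hθ0.le]
      field_simp
    have e2 : (N / θ) ^ (2 : ℝ) ≤ (N / θ) ^ (1 - α) :=
      Real.rpow_le_rpow_of_exponent_ge (by positivity)
        ((div_le_one hθ0).2 (by linarith)) (by linarith)
    rw [e]
    refine le_trans ?_ e2
    rw [Real.rpow_two, div_pow, sub_le_iff_le_add, ← sub_nonneg]
    have : N ^ 2 / θ ^ 2 + 2 * (θ - N) / N - 1 =
        (θ - N) ^ 2 * (2 * θ + N) / (N * θ ^ 2) := by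
      field_simp
      ring
    rw [this]
    positivity
  have hNN : N ^ (3 - α) = N ^ 2 * N ^ (1 - α) := by
    rw [← Real.rpow_two, ← Real.rpow_add hN0]
    ring_nf
  set y := θ ^ (α - 1) with hy
  have hy0 : 0 ≤ y := by positivity
  have hyN : y ≤ N ^ α := by
    calc y ≤ N ^ (α - 1) := Real.rpow_le_rpow_of_nonpos hN0 (by linarith) (by linarith)
      _ ≤ N ^ α := Real.rpow_le_rpow_of_exponent_le hN (by linarith)
  set Q := -α * y with hQ
  have hQ0 : 0 ≤ Q := mul_nonneg (by linarith) hy0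
  have hQN : Q ≤ N ^ α := le_trans (by rw [hQ]; nlinarith) hyN
  have hNα1 : N ^ α ≤ 1 := Real.rpow_le_one_of_one_le_of_nonpos hN hα2.le
  have hNα0 : 0 < N ^ α := by positivity
  have hQd : Q * d₀ ^ 2 = 3 * N ^ 2 * (y * N ^ (1 - α)) := by
    rw [hQ, mul_right_comm, hd₀N, hNN]
    ring
  set R := y * N ^ (1 - α)
  have hγN' : γ ≤ N := by linarith
  have m1 : |Q * d₀ ^ 2 - 3 * c ^ 2| ≤ 54 * (γ * N) := by
    have u1 : N ^ 2 * (1 - R) ≤ 10 * (γ * N) := by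
      have : 1 - R ≤ 2 * (θ - N) / N := by linarith
      calc N ^ 2 * (1 - R) ≤ N ^ 2 * (2 * (θ - N) / N) := by gcongr
        _ = 2 * N * (θ - N) := by field_simp
        _ ≤ 2 * N * (5 * γ) := by gcongr; linarith
        _ = 10 * (γ * N) := by ring
    have u2 : 0 ≤ N ^ 2 * (1 - R) := mul_nonneg (by positivity) (by linarith)
    have u3 : c ^ 2 - N ^ 2 ≤ 8 * (γ * N) := by nlinarith
    have u4 : 0 ≤ c ^ 2 - N ^ 2 := by nlinarith
    have u5 : 0 ≤ γ * N := by positivity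
    rw [hQd, abs_le]
    constructor <;> linarith
  have t1 : |a * (Q * d₀ ^ 2 - 3 * c ^ 2)| ≤ 162 / 1000 := by
    rw [abs_mul, abs_of_pos ha0]
    calc a * |Q * d₀ ^ 2 - 3 * c ^ 2| ≤ 3 * γ * (54 * (γ * N)) := by gcongr
      _ = 162 * (γ ^ 2 * N) := by ring
      _ ≤ 162 / 1000 := by linarith
  have t2 : |3 * a ^ 2 * c| ≤ 81 / 1000 := by
    rw [abs_of_nonneg (by positivity)]
    calc 3 * a ^ 2 * c ≤ 3 * (3 * γ) ^ 2 * (3 * N) := by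
          have : c ≤ 3 * N := by linarith
          gcongr
      _ = 81 * (γ ^ 2 * N) := by ring
      _ ≤ 81 / 1000 := by linarith
  have hhs : h ^ 2 ≤ 1 / 1000 := by nlinarith
  have t3 : |a * Q * (d ^ 2 - d₀ ^ 2)| ≤ 9 / 1000 := by
    have v : |d ^ 2 - d₀ ^ 2| ≤ 2 * h * d₀ + h ^ 2 := by
      have : d ^ 2 - d₀ ^ 2 = 2 * d₀ * (d - d₀) + (d - d₀) ^ 2 := by ring
      rw [this]
      refine (abs_add_le _ _).trans ?_
      rw [abs_mul, abs_of_nonneg (by positivity : 0 ≤ 2 * d₀), abs_pow]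
      have := abs_nonneg (d - d₀)
      nlinarith
    rw [abs_mul, abs_of_nonneg (by positivity : 0 ≤ a * Q)]
    calc a * Q * |d ^ 2 - d₀ ^ 2| ≤ 3 * N ^ α * (2 * h * d₀ + h ^ 2) := by
          gcongr; linarith
      _ = 6 * (h * (N ^ α * d₀)) + 3 * (N ^ α * h ^ 2) := by ring
      _ ≤ 6 * (1 / 1000) + 3 * (1 * (1 / 1000)) := by gcongr
      _ = 9 / 1000 := by norm_num
  have hb2 : b ^ 2 ≤ h ^ 2 := sq_le_sq' (by linarith [(abs_le.1 hb).1]) (abs_le.1 hb).2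
  have t4 : |a ^ α * b ^ 2| ≤ 1 / 1000 := by
    rw [abs_of_nonneg (by positivity)]
    have w : a ^ α ≤ γ⁻¹ := by
      calc a ^ α ≤ γ ^ α := Real.rpow_le_rpow_of_nonpos hγ0 ha1 hα2.le
        _ ≤ γ ^ (-1 : ℝ) := Real.rpow_le_rpow_of_exponent_ge hγ0 hγ1 hα1
        _ = γ⁻¹ := Real.rpow_neg_one γ
    calc a ^ α * b ^ 2 ≤ γ⁻¹ * (γ * (1 / 1000)) := by gcongr; linarith
      _ = 1 / 1000 := by field_simp
  have t5 : |(a + c) ^ α * (2 * b * d + b ^ 2)| ≤ 5 / 1000 := by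
    have w : (a + c) ^ α ≤ N ^ α := Real.rpow_le_rpow_of_nonpos hN0 (by linarith) hα2.le
    have hd' : |d| ≤ d₀ + h := by
      have := abs_sub_abs_le_abs_sub d d₀
      rw [abs_of_nonneg hd₀] at this
      linarith
    have v : |2 * b * d + b ^ 2| ≤ 2 * h * (d₀ + h) + h ^ 2 := by
      refine (abs_add_le _ _).trans ?_
      rw [abs_of_nonneg (sq_nonneg b), abs_mul, abs_mul, abs_two]
      gcongr
    rw [abs_mul, abs_of_nonneg (by positivity : 0 ≤ (a + c) ^ α)]
    calc (a + c) ^ α * |2 * b * d + b ^ 2| ≤ N ^ α * (2 * h * (d₀ + h) + h ^ 2) := by gcongr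
      _ = 2 * (h * (N ^ α * d₀)) + 3 * (N ^ α * h ^ 2) := by ring
      _ ≤ 2 * (1 / 1000) + 3 * (1 * (1 / 1000)) := by gcongr
      _ = 5 / 1000 := by norm_num
  have key : a ^ 3 + a ^ α * b ^ 2 + (c ^ 3 + c ^ α * d ^ 2) -
      ((a + c) ^ 3 + (a + c) ^ α * (b + d) ^ 2) =
      a * (Q * d₀ ^ 2 - 3 * c ^ 2) - 3 * a ^ 2 * c + a * Q * (d ^ 2 - d₀ ^ 2) + a ^ α * b ^ 2 -
        (a + c) ^ α * (2 * b * d + b ^ 2) := by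
    have : c ^ α = (a + c) ^ α + a * Q := by linarith
    rw [this]
    ring
  rw [key, abs_le]
  rw [abs_le] at t1 t2 t3 t4 t5
  constructor <;> linarith [t1.1, t1.2, t2.1, t2.2, t3.1, t3.2, t4.1, t4.2, t5.1, t5.2]

/-- The weight of the anisotropic Sobolev space. -/
def weight (s₁ s₂ : ℝ) (p : ℝ × ℝ) : ℝ := (1 + p.1 ^ 2) ^ s₁ + (1 + p.2 ^ 2) ^ s₂

lemma weight_pos (s₁ s₂ : ℝ) (p : ℝ × ℝ) : 0 < weight s₁ s₂ p := by
  unfold weight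
  positivity

lemma continuous_weight (s₁ s₂ : ℝ) : Continuous (weight s₁ s₂) := by
  unfold weight
  exact (Continuous.rpow_const (by fun_prop) fun p => Or.inl (by positivity)).add
    (Continuous.rpow_const (by fun_prop) fun p => Or.inl (by positivity))

lemma rpow_one_add_sq_le {x y : ℝ} (hxy : |x - y| ≤ 1) (s : ℝ) :
    (1 + x ^ 2) ^ s ≤ 4 ^ |s| * (1 + y ^ 2) ^ s := by
  have key : ∀ {x y : ℝ}, |x - y| ≤ 1 → 1 + x ^ 2 ≤ 4 * (1 + y ^ 2) := by
    intro x y h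
    have := (sq_le_one_iff_abs_le_one _).2 h
    nlinarith [sq_nonneg (x - 2 * y)]
  rcases le_total 0 s with hs | hs
  · rw [abs_of_nonneg hs, ← Real.mul_rpow (by norm_num) (by positivity)]
    exact Real.rpow_le_rpow (by positivity) (key hxy) hs
  · rw [abs_of_nonpos hs]
    have h1 : (4 * (1 + x ^ 2)) ^ s ≤ (1 + y ^ 2) ^ s :=
      Real.rpow_le_rpow_of_nonpos (by positivity) (key (by rwa [abs_sub_comm])) hs
    rw [Real.mul_rpow (by norm_num) (by positivity)] at h1
    calc (1 + x ^ 2) ^ s = 4 ^ (-s) * (4 ^ s * (1 + x ^ 2) ^ s) := by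
          rw [← mul_assoc, ← Real.rpow_add (by norm_num)]
          simp
      _ ≤ 4 ^ (-s) * (1 + y ^ 2) ^ s := by gcongr

lemma weight_le (s₁ s₂ : ℝ) {p q : ℝ × ℝ} (h1 : |p.1 - q.1| ≤ 1) (h2 : |p.2 - q.2| ≤ 1) :
    weight s₁ s₂ p ≤ 4 ^ (|s₁| + |s₂|) * weight s₁ s₂ q := by
  have e1 : (4 : ℝ) ^ |s₁| ≤ 4 ^ (|s₁| + |s₂|) :=
    Real.rpow_le_rpow_of_exponent_le (by norm_num) (by linarith [abs_nonneg s₂])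
  have e2 : (4 : ℝ) ^ |s₂| ≤ 4 ^ (|s₁| + |s₂|) :=
    Real.rpow_le_rpow_of_exponent_le (by norm_num) (by linarith [abs_nonneg s₁])
  unfold weight
  rw [mul_add]
  refine add_le_add ((rpow_one_add_sq_le h1 s₁).trans ?_) ((rpow_one_add_sq_le h2 s₂).trans ?_) <;>
    gcongr
/-- Lower bound for the second Picard iterate at a frequency where all interactions are nearly
resonant. -/
lemma le_norm_duhamelProfile {α : ℝ} {g : ℝ × ℝ → ℝ} {K Q : Set (ℝ × ℝ)} {k : ℝ × ℝ} {t m : ℝ}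
    (hg : ContDiff ℝ ∞ g) (hg0 : ∀ p, 0 ≤ g p) (hK : IsCompact K) (hK0 : ∀ p ∈ K, 0 < p.1)
    (hgK : ∀ p ∉ K, g p = 0) (ht0 : 0 ≤ t) (ht1 : t ≤ 1)
    (hres : ∀ p ∈ K, k - p ∈ K → |disp α p + disp α (k - p) - disp α k| ≤ 1)
    (hQ : MeasurableSet Q) (hQfin : volume Q ≠ ⊤)
    (hm : ∀ p ∈ Q, m ≤ g p * g (k - p) * (k - p).1) :
    t * (m * volume.real Q) ≤ ‖duhamelProfile α (fun p => (g p : ℂ)) t k‖ := by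
  have hf : ContDiff ℝ ∞ fun p => (g p : ℂ) := Complex.ofRealCLM.contDiff.comp hg
  have hfK : ∀ p ∉ K, (g p : ℂ) = 0 := fun p hp => by rw [hgK p hp, Complex.ofReal_zero]
  have hpi : (Real.pi : ℂ) ≠ 0 := Complex.ofReal_ne_zero.2 Real.pi_ne_zero
  let Z : ℝ → ℂ := fun s => Complex.exp (Complex.I * (s : ℂ) * (disp α k : ℂ)) *
    ((2 * Real.pi * Complex.I)⁻¹ * nonlinProfile α (fun p => (g p : ℂ)) s k)
  have hN : Continuous fun s => nonlinProfile α (fun p => (g p : ℂ)) s k :=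
    Continuous.comp
      (g := fun q : (ℝ × ℝ) × ℝ => nonlinProfile α (fun p => (g p : ℂ)) q.2 q.1)
      (f := fun s : ℝ => (k, s)) (contDiff_nonlinProfile hf hK hK0 hfK).continuous
      (Continuous.prodMk continuous_const continuous_id)
  have hZ : Continuous Z := by fun_prop
  have hduh : duhamelProfile α (fun p => (g p : ℂ)) t k =
      Complex.exp (((-(t * disp α k) : ℝ) : ℂ) * Complex.I) * (2 * Real.pi * Complex.I) *
        ∫ s in (0 : ℝ)..t, Z s := by
    rw [duhamelProfile, ← intervalIntegral.integral_const_mul]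
    refine intervalIntegral.integral_congr fun s _ => ?_
    simp only [Z]
    rw [mul_mul_mul_comm, ← Complex.exp_add, ← mul_assoc (2 * (Real.pi : ℂ) * Complex.I),
      mul_inv_cancel₀ (by simp [hpi]), one_mul]
    congr 2
    push_cast
    ring
  have hre : ∀ s ∈ Set.Icc 0 t, m * volume.real Q / 2 ≤ (Z s).re := by
    intro s hs
    have hE := (contDiff_freeProfile (α := α) hf hK hK0 hfK s).continuous
    have hEc := hasCompactSupport_freeProfile (α := α) (HasCompactSupport.intro hK hfK) s
    let ζ : ℝ × ℝ → ℂ := fun p => Complex.exp (Complex.I * (s : ℂ) * (disp α k : ℂ)) *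
      ((2 * Real.pi * Complex.I)⁻¹ * (freeProfile α (fun p => (g p : ℂ)) s p *
        (2 * Real.pi * Complex.I * ((k - p).1 : ℂ) *
          freeProfile α (fun p => (g p : ℂ)) s (k - p))))
    have hζint : Integrable ζ := by
      have h1 : Continuous fun p : ℝ × ℝ => ((k - p).1 : ℂ) := by
        exact Complex.continuous_ofReal.comp (continuous_fst.comp (continuous_const.sub continuous_id))
      have h2 : Continuous fun p : ℝ × ℝ => freeProfile α (fun p => (g p : ℂ)) s (k - p) :=
        hE.comp (continuous_const.sub continuous_id)
      exact Continuous.integrable_of_hasCompactSupport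
        (continuous_const.mul (continuous_const.mul (hE.mul ((continuous_const.mul h1).mul h2))))
        (hEc.mul_right.mul_left.mul_left)
    have hZζ : Z s = ∫ p, ζ p := by
      simp only [Z, ζ, nonlinProfile, integral_const_mul]
    have hζ : ∀ p, (ζ p).re = Real.cos (s * (disp α p + disp α (k - p) - disp α k)) *
        (g p * g (k - p) * (k - p).1) := by
      intro p
      have : ζ p = Complex.exp (((-(s * (disp α p + disp α (k - p) - disp α k)) : ℝ) : ℂ) *
          Complex.I) * ((g p * g (k - p) * (k - p).1 : ℝ) : ℂ) := by
        have e : ((-(s * (disp α p + disp α (k - p) - disp α k)) : ℝ) : ℂ) * Complex.I =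
            Complex.I * (s : ℂ) * (disp α k : ℂ) + (-Complex.I * (s : ℂ) * (disp α p : ℂ)) +
              (-Complex.I * (s : ℂ) * (disp α (k - p) : ℂ)) := by
          push_cast
          ring
        rw [e, Complex.exp_add, Complex.exp_add]
        simp only [ζ, freeProfile]
        push_cast
        field_simp
      rw [this, Complex.re_mul_ofReal, Complex.exp_ofReal_mul_I_re, Real.cos_neg]
    have hζge : ∀ p, g p * g (k - p) * (k - p).1 / 2 ≤ (ζ p).re ∧ 0 ≤ (ζ p).re := by
      intro p
      rw [hζ]
      by_cases hp : p ∈ K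
      · by_cases hkp : k - p ∈ K
        · have hx : 0 ≤ g p * g (k - p) * (k - p).1 :=
            mul_nonneg (mul_nonneg (hg0 _) (hg0 _)) (hK0 _ hkp).le
          have hθ : |s * (disp α p + disp α (k - p) - disp α k)| ≤ 1 := by
            rw [abs_mul, abs_of_nonneg hs.1]
            exact mul_le_one₀ (hs.2.trans ht1) (abs_nonneg _) (hres p hp hkp)
          have hcos := Real.one_sub_sq_div_two_le_cos
            (x := s * (disp α p + disp α (k - p) - disp α k))
          have hsq := (sq_le_one_iff_abs_le_one _).2 hθ
          have hc : 1 / 2 ≤ Real.cos (s * (disp α p + disp α (k - p) - disp α k)) := by linarith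
          constructor
          · calc _ = 1 / 2 * (g p * g (k - p) * (k - p).1) := by ring
              _ ≤ _ := by gcongr
          · exact mul_nonneg (by linarith) hx
        · simp [hgK _ hkp]
      · simp [hgK _ hp]
    have hζre : Integrable fun p => (ζ p).re := hζint.re
    have e1 : (Z s).re = ∫ p, (ζ p).re := by
      rw [hZζ]
      exact (integral_re hζint).symm
    rw [e1]
    calc m * volume.real Q / 2 = ∫ _ in Q, m / 2 := by
          rw [setIntegral_const, smul_eq_mul]
          ring
      _ ≤ ∫ p in Q, (ζ p).re := by
          refine setIntegral_mono_on (integrableOn_const hQfin) hζre.integrableOn hQ fun p hp => ?_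
          exact le_trans (by linarith [hm p hp]) (hζge p).1
      _ ≤ ∫ p, (ζ p).re :=
          setIntegral_le_integral hζre (Eventually.of_forall fun p => (hζge p).2)
  have hint : t * (m * volume.real Q / 2) ≤ ‖∫ s in (0 : ℝ)..t, Z s‖ := by
    have e2 : (∫ s in (0 : ℝ)..t, Z s).re = ∫ s in (0 : ℝ)..t, (Z s).re :=
      (Complex.reCLM.intervalIntegral_comp_comm (hZ.intervalIntegrable 0 t)).symm
    refine le_trans ?_ (Complex.re_le_norm _)
    rw [e2]
    have := intervalIntegral.integral_mono_on (μ := volume)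
      (f := fun _ => m * volume.real Q / 2) (g := fun s => (Z s).re) ht0
      (continuous_const.intervalIntegrable 0 t)
      ((Complex.continuous_re.comp hZ).intervalIntegrable 0 t) hre
    rw [intervalIntegral.integral_const, smul_eq_mul, sub_zero] at this
    exact this
  rw [hduh, norm_mul, norm_mul, Complex.norm_exp_ofReal_mul_I, one_mul]
  have hn : ‖(2 * Real.pi * Complex.I : ℂ)‖ = 2 * Real.pi := by
    simp [abs_of_pos Real.pi_pos]
  rw [hn]
  have h0 := norm_nonneg (∫ s in (0 : ℝ)..t, Z s)
  nlinarith [Real.pi_gt_three]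

lemma sq_HNorm2 (s₁ s₂ : ℝ) (f : ℝ × ℝ → ℂ) :
    HNorm2 s₁ s₂ f ^ 2 = ∫ p, weight s₁ s₂ p * ‖FT2 f p‖ ^ 2 :=
  Real.sq_sqrt (integral_nonneg fun p => mul_nonneg (weight_pos s₁ s₂ p).le (by positivity))
lemma volume_real_Icc_prod_Icc {a b c d : ℝ} (hab : a ≤ b) (hcd : c ≤ d) :
    volume.real (Set.Icc a b ×ˢ Set.Icc c d) = (b - a) * (d - c) := by
  rw [Measure.volume_eq_prod, measureReal_prod_prod, Real.volume_real_Icc_of_le hab,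
    Real.volume_real_Icc_of_le hcd]

lemma ContDiffBump.eq_zero_of_notMem_Icc {c : ℝ} (χ : ContDiffBump c) {x : ℝ}
    (hx : x ∉ Set.Icc (c - χ.rOut) (c + χ.rOut)) : χ x = 0 := by
  refine χ.zero_of_le_dist (le_of_lt ?_)
  rw [← Real.closedBall_eq_Icc, Metric.mem_closedBall, not_le] at hx
  exact hx

lemma ContDiffBump.eq_one_of_mem_Icc {c : ℝ} (χ : ContDiffBump c) {x : ℝ}
    (hx : x ∈ Set.Icc (c - χ.rIn) (c + χ.rIn)) : χ x = 1 := by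
  rw [← Real.closedBall_eq_Icc] at hx
  exact χ.one_of_mem_closedBall hx

/-- A bilinear estimate for the second Picard iterate at time `t` bounds the size of the nearly
resonant interaction of a low and a high frequency box. -/
lemma le_of_picard_bound {s₁ s₂ α C t N γ h d₀ : ℝ} (hα1 : -1 ≤ α) (hα2 : α < 0) (hN : 1 ≤ N)
    (hγ0 : 0 < γ) (hγ1 : γ ≤ 1 / 8) (hγN : γ ^ 2 * N ≤ 1 / 1000) (hh0 : 0 < h) (hh1 : h ≤ 1)
    (hd₀ : 0 ≤ d₀) (hd₀N : -α * d₀ ^ 2 = 3 * N ^ (3 - α)) (h1 : h * (N ^ α * d₀) ≤ 1 / 1000)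
    (h2 : h ^ 2 ≤ γ * (1 / 1000)) (ht0 : 0 ≤ t) (ht1 : t ≤ 1)
    (H : ∀ φ : ℝ × ℝ → ℂ, MemH s₁ s₂ φ →
      HNorm2 s₁ s₂ (fun z => ∫ t' in (0 : ℝ)..t, Wgrp α (t - t')
        (fun w => Wgrp α t' φ w * deriv (fun a => Wgrp α t' φ (a, w.2)) w.1) z) ≤
        C * HNorm2 s₁ s₂ φ ^ 2) :
    t ^ 2 * (N ^ 2 * (γ * h)) ≤ 9216 * (4 ^ (|s₁| + |s₂|)) ^ 3 * C ^ 2 := by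
  set B : ℝ := 4 ^ (|s₁| + |s₂|) with hB
  have hB0 : 0 < B := by positivity
  set W₀ : ℝ := weight s₁ s₂ (N, d₀) with hW₀
  have hW₀pos : 0 < W₀ := weight_pos _ _ _
  set A : ℝ := (Real.sqrt W₀)⁻¹ with hA
  have hA0 : 0 < A := by positivity
  have hAW : A ^ 2 * W₀ = 1 := by
    rw [hA, inv_pow, Real.sq_sqrt hW₀pos.le, inv_mul_cancel₀ hW₀pos.ne']
  let X₁ : ContDiffBump (2 * γ) := ⟨γ / 2, γ, by linarith, by linarith⟩
  let Y₁ : ContDiffBump (0 : ℝ) := ⟨h / 2, h, by linarith, by linarith⟩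
  let X₂ : ContDiffBump (N + γ) := ⟨γ / 2, γ, by linarith, by linarith⟩
  let Y₂ : ContDiffBump d₀ := ⟨h / 2, h, by linarith, by linarith⟩
  let g : ℝ × ℝ → ℝ := fun p => X₁ p.1 * Y₁ p.2 + A * (X₂ p.1 * Y₂ p.2)
  let K₁ : Set (ℝ × ℝ) := Set.Icc γ (3 * γ) ×ˢ Set.Icc (-h) h
  let K₂ : Set (ℝ × ℝ) := Set.Icc N (N + 2 * γ) ×ˢ Set.Icc (d₀ - h) (d₀ + h)
  have hK₁ : IsCompact K₁ := isCompact_Icc.prod isCompact_Icc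
  have hK₂ : IsCompact K₂ := isCompact_Icc.prod isCompact_Icc
  have hK : IsCompact (K₁ ∪ K₂) := hK₁.union hK₂
  have hK0 : ∀ p ∈ K₁ ∪ K₂, 0 < p.1 := by
    rintro p (⟨⟨hp, -⟩, -⟩ | ⟨⟨hp, -⟩, -⟩) <;> linarith
  have hz₁ : ∀ p ∉ K₁, X₁ p.1 * Y₁ p.2 = 0 := by
    intro p hp
    by_cases hx : p.1 ∈ Set.Icc γ (3 * γ)
    · rw [Y₁.eq_zero_of_notMem_Icc (x := p.2), mul_zero]
      intro hy
      exact hp ⟨hx, by simpa [Y₁] using hy⟩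
    · rw [X₁.eq_zero_of_notMem_Icc (x := p.1), zero_mul]
      rintro ⟨hx1, hx2⟩
      simp only [X₁] at hx1 hx2
      exact hx ⟨by linarith, by linarith⟩
  have hz₂ : ∀ p ∉ K₂, X₂ p.1 * Y₂ p.2 = 0 := by
    intro p hp
    by_cases hx : p.1 ∈ Set.Icc N (N + 2 * γ)
    · rw [Y₂.eq_zero_of_notMem_Icc (x := p.2), mul_zero]
      exact fun hy => hp ⟨hx, hy⟩
    · rw [X₂.eq_zero_of_notMem_Icc (x := p.1), zero_mul]
      rintro ⟨hx1, hx2⟩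
      simp only [X₂] at hx1 hx2
      exact hx ⟨by linarith, by linarith⟩
  have hgK : ∀ p ∉ K₁ ∪ K₂, g p = 0 := by
    intro p hp
    rw [Set.mem_union, not_or] at hp
    simp only [g, hz₁ p hp.1, hz₂ p hp.2, mul_zero, add_zero]
  have hg : ContDiff ℝ ∞ g :=
    ((X₁.contDiff.comp contDiff_fst).mul (Y₁.contDiff.comp contDiff_snd)).add
      (contDiff_const.mul ((X₂.contDiff.comp contDiff_fst).mul (Y₂.contDiff.comp contDiff_snd)))
  have hp₁ : ∀ p : ℝ × ℝ, 0 ≤ X₁ p.1 * Y₁ p.2 := fun p => mul_nonneg X₁.nonneg Y₁.nonneg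
  have hp₂ : ∀ p : ℝ × ℝ, 0 ≤ X₂ p.1 * Y₂ p.2 := fun p => mul_nonneg X₂.nonneg Y₂.nonneg
  have hg0 : ∀ p, 0 ≤ g p := fun p => add_nonneg (hp₁ p) (mul_nonneg hA0.le (hp₂ p))
  have hf : ContDiff ℝ ∞ fun p => (g p : ℂ) := Complex.ofRealCLM.contDiff.comp hg
  have hfK : ∀ p ∉ K₁ ∪ K₂, (g p : ℂ) = 0 := fun p hp => by
    rw [hgK p hp, Complex.ofReal_zero]
  have hfc : HasCompactSupport fun p => (g p : ℂ) := HasCompactSupport.intro hK hfK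
  have hFT := FT2_IFT2 hf hfc
  have hint : ∀ {u : ℝ × ℝ → ℂ}, Continuous u → HasCompactSupport u →
      Integrable fun p => weight s₁ s₂ p * ‖u p‖ ^ 2 := fun hu huc =>
    Continuous.integrable_of_hasCompactSupport
      ((continuous_weight s₁ s₂).mul (hu.norm.pow 2))
      (huc.norm.comp_left (g := fun x : ℝ => x ^ 2) (by norm_num)).mul_left
  have hmem : MemH s₁ s₂ (IFT2 fun p => (g p : ℂ)) := by
    have := hint hf.continuous hfc
    rw [MemH, hFT]
    exact this
  have hφ : HNorm2 s₁ s₂ (IFT2 fun p => (g p : ℂ)) ^ 2 ≤ 12 * B * (γ * h) := by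
    rw [sq_HNorm2, hFT]
    have hb : ∀ p, weight s₁ s₂ p * ‖(g p : ℂ)‖ ^ 2 ≤
        K₁.indicator (fun _ => 2 * B) p + K₂.indicator (fun _ => B) p := by
      intro p
      rw [Complex.norm_real, Real.norm_eq_abs, sq_abs]
      by_cases hp1 : p ∈ K₁
      · have hp2 : p ∉ K₂ := by
          rintro ⟨⟨hx, -⟩, -⟩
          linarith [hp1.1.2]
        rw [Set.indicator_of_mem hp1, Set.indicator_of_notMem hp2, add_zero]
        simp only [g, hz₂ p hp2, mul_zero, add_zero]
        have hw : weight s₁ s₂ p ≤ B * weight s₁ s₂ (0, 0) := by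
          refine weight_le s₁ s₂ ?_ ?_ <;> rw [sub_zero, abs_le]
          · constructor <;> linarith [hp1.1.1, hp1.1.2]
          · constructor <;> linarith [hp1.2.1, hp1.2.2]
        have hw0 : weight s₁ s₂ (0, 0) = 2 := by norm_num [weight]
        rw [hw0] at hw
        have hx : (X₁ p.1 * Y₁ p.2) ^ 2 ≤ 1 :=
          pow_le_one₀ (hp₁ p) (mul_le_one₀ X₁.le_one Y₁.nonneg Y₁.le_one)
        calc _ ≤ (B * 2) * 1 := mul_le_mul hw hx (sq_nonneg _) (by positivity)
          _ = 2 * B := by ring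
      · rw [Set.indicator_of_notMem hp1, zero_add]
        simp only [g, hz₁ p hp1, zero_add]
        by_cases hp2 : p ∈ K₂
        · rw [Set.indicator_of_mem hp2]
          have hw : weight s₁ s₂ p ≤ B * W₀ := by
            refine weight_le s₁ s₂ ?_ ?_ <;> rw [abs_le]
            · constructor <;> linarith [hp2.1.1, hp2.1.2]
            · constructor <;> linarith [hp2.2.1, hp2.2.2]
          have hx : (X₂ p.1 * Y₂ p.2) ^ 2 ≤ 1 :=
            pow_le_one₀ (hp₂ p) (mul_le_one₀ X₂.le_one Y₂.nonneg Y₂.le_one)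
          rw [mul_pow]
          calc _ ≤ (B * W₀) * (A ^ 2 * 1) := by gcongr
            _ = B * (A ^ 2 * W₀) := by ring
            _ = B := by rw [hAW, mul_one]
        · rw [Set.indicator_of_notMem hp2, hz₂ p hp2]
          simp
    have hi₁ : Integrable (K₁.indicator fun _ => 2 * B) :=
      (integrable_indicator_iff hK₁.measurableSet).2 (integrableOn_const hK₁.measure_ne_top)
    have hi₂ : Integrable (K₂.indicator fun _ => B) :=
      (integrable_indicator_iff hK₂.measurableSet).2 (integrableOn_const hK₂.measure_ne_top)
    refine (integral_mono (hint hf.continuous hfc) (hi₁.add hi₂) hb).trans (le_of_eq ?_)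
    simp only [Pi.add_apply]
    rw [integral_add hi₁ hi₂, integral_indicator hK₁.measurableSet,
      integral_indicator hK₂.measurableSet, setIntegral_const, setIntegral_const,
      volume_real_Icc_prod_Icc (by linarith) (by linarith),
      volume_real_Icc_prod_Icc (by linarith) (by linarith), smul_eq_mul, smul_eq_mul]
    ring
  let R : Set (ℝ × ℝ) := Set.Icc (N + 3 * γ - γ / 4) (N + 3 * γ + γ / 4) ×ˢ
    Set.Icc (d₀ - h / 4) (d₀ + h / 4)
  have hR : IsCompact R := isCompact_Icc.prod isCompact_Icc
  have hlow : ∀ k ∈ R, t * (A * N * (γ * h / 4)) ≤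
      ‖duhamelProfile α (fun p => (g p : ℂ)) t k‖ := by
    rintro k ⟨⟨hk1, hk2⟩, hk3, hk4⟩
    let Q : Set (ℝ × ℝ) := Set.Icc (2 * γ - γ / 4) (2 * γ + γ / 4) ×ˢ Set.Icc (-(h / 4)) (h / 4)
    have hQ : IsCompact Q := isCompact_Icc.prod isCompact_Icc
    have hvol : volume.real Q = γ * h / 4 := by
      rw [volume_real_Icc_prod_Icc (by linarith) (by linarith)]
      ring
    have hres : ∀ p q, p ∈ K₁ → q ∈ K₂ → |disp α p + disp α q - disp α (p + q)| ≤ 1 := by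
      rintro ⟨a, b⟩ ⟨c, d⟩ ⟨⟨ha1, ha2⟩, hb1, hb2⟩ ⟨⟨hc1, hc2⟩, hd1, hd2⟩
      dsimp only at *
      exact abs_resonance_le hα1 hα2 hN hγ0 (by linarith) hγN hh0.le hd₀ hd₀N h1 h2 ha1 ha2
        (abs_le.2 ⟨hb1, hb2⟩) hc1 hc2 (abs_le.2 ⟨by linarith, by linarith⟩)
    rw [← hvol]
    refine le_norm_duhamelProfile hg hg0 hK hK0 hgK ht0 ht1 ?_ hQ.measurableSet
      hQ.measure_ne_top ?_
    · rintro p (hp | hp) (hq | hq)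
      · have e1 := hp.1.2
        have e2 := hq.1.2
        rw [Prod.fst_sub] at e2
        exfalso
        linarith
      · simpa using hres p (k - p) hp hq
      · have := hres (k - p) p hq hp
        rwa [sub_add_cancel, add_comm (disp α (k - p))] at this
      · have e1 := hp.1.1
        have e2 := hq.1.1
        rw [Prod.fst_sub] at e2
        exfalso
        linarith
    · rintro p ⟨⟨ha1, ha2⟩, hb1, hb2⟩
      have f1 : 1 ≤ g p := by
        have x1 : X₁ p.1 = 1 := X₁.eq_one_of_mem_Icc (by
          simp only [X₁]
          constructor <;> linarith)
        have y1 : Y₁ p.2 = 1 := Y₁.eq_one_of_mem_Icc (by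
          simp only [Y₁]
          constructor <;> linarith)
        have := mul_nonneg hA0.le (hp₂ p)
        simp only [g, x1, y1]
        linarith
      have f2 : A ≤ g (k - p) := by
        have x2 : X₂ (k - p).1 = 1 := X₂.eq_one_of_mem_Icc (by
          simp only [X₂, Prod.fst_sub]
          constructor <;> linarith)
        have y2 : Y₂ (k - p).2 = 1 := Y₂.eq_one_of_mem_Icc (by
          simp only [Y₂, Prod.snd_sub]
          constructor <;> linarith)
        have := hp₁ (k - p)
        simp only [g, x2, y2]
        linarith
      have f3 : N ≤ (k - p).1 := by
        rw [Prod.fst_sub]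
        linarith
      calc A * N = 1 * A * N := by ring
        _ ≤ g p * g (k - p) * (k - p).1 := by gcongr; exact mul_nonneg (hg0 _) (hg0 _)
  have hdc := (contDiff_duhamelProfile (α := α) hf hK hK0 hfK ht0).continuous
  have hds := hasCompactSupport_duhamelProfile (α := α) hK hfK t
  have hLHS := H _ hmem
  have hlower : γ * h / 4 * (W₀ / B * (t * (A * N * (γ * h / 4))) ^ 2) ≤
      HNorm2 s₁ s₂ (fun z => ∫ t' in (0 : ℝ)..t, Wgrp α (t - t')
        (fun w => Wgrp α t' (IFT2 fun p => (g p : ℂ)) w *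
          deriv (fun a => Wgrp α t' (IFT2 fun p => (g p : ℂ)) (a, w.2)) w.1) z) ^ 2 := by
    rw [sq_HNorm2, FT2_duhamel hf hK hK0 hfK ht0]
    have hvol : volume.real R = γ * h / 4 := by
      rw [volume_real_Icc_prod_Icc (by linarith) (by linarith)]
      ring
    calc γ * h / 4 * (W₀ / B * (t * (A * N * (γ * h / 4))) ^ 2)
        = ∫ _ in R, W₀ / B * (t * (A * N * (γ * h / 4))) ^ 2 := by
          rw [setIntegral_const, hvol, smul_eq_mul]
      _ ≤ ∫ k in R, weight s₁ s₂ k * ‖duhamelProfile α (fun p => (g p : ℂ)) t k‖ ^ 2 := by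
          refine setIntegral_mono_on (integrableOn_const hR.measure_ne_top)
            (hint hdc hds).integrableOn hR.measurableSet fun k hk => ?_
          have hw : W₀ / B ≤ weight s₁ s₂ k := by
            rw [div_le_iff₀' hB0]
            refine weight_le s₁ s₂ ?_ ?_ <;> rw [abs_le]
            · constructor <;> linarith [hk.1.1, hk.1.2]
            · constructor <;> linarith [hk.2.1, hk.2.2]
          have := hlow k hk
          have := (weight_pos s₁ s₂ k).le
          gcongr
      _ ≤ ∫ k, weight s₁ s₂ k * ‖duhamelProfile α (fun p => (g p : ℂ)) t k‖ ^ 2 :=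
          setIntegral_le_integral (hint hdc hds) (Eventually.of_forall fun k =>
            mul_nonneg (weight_pos s₁ s₂ k).le (by positivity))
  have hfin := hlower.trans (pow_le_pow_left₀ (Real.sqrt_nonneg _) hLHS 2)
  have hfin2 : γ * h / 4 * (W₀ / B * (t * (A * N * (γ * h / 4))) ^ 2) ≤
      C ^ 2 * (12 * B * (γ * h)) ^ 2 := by
    refine hfin.trans ?_
    rw [mul_pow]
    gcongr
  have hγh : 0 < γ * h := by positivity
  have e : γ * h / 4 * (W₀ / B * (t * (A * N * (γ * h / 4))) ^ 2) =
      (γ * h) ^ 2 / (64 * B) * (t ^ 2 * (N ^ 2 * (γ * h))) := by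
    calc _ = (γ * h) ^ 2 / (64 * B) * (t ^ 2 * (N ^ 2 * (γ * h))) * (A ^ 2 * W₀) := by ring
      _ = _ := by rw [hAW, mul_one]
  rw [e] at hfin2
  have e3 : C ^ 2 * (12 * B * (γ * h)) ^ 2 =
      (γ * h) ^ 2 / (64 * B) * (9216 * B ^ 3 * C ^ 2) := by
    field_simp
    ring
  rw [e3] at hfin2
  exact le_of_mul_le_mul_left hfin2 (by positivity)

theorem stmt18 (s₁ s₂ α : ℝ) (hα1 : -1 ≤ α) (hα2 : α < 0) :
    ¬ ∃ T > (0 : ℝ), ∃ C > (0 : ℝ), ∀ φ : ℝ × ℝ → ℂ, MemH s₁ s₂ φ →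
      ∀ t ∈ Set.Icc (0 : ℝ) T,
        HNorm2 s₁ s₂ (fun z =>
            ∫ t' in (0 : ℝ)..t,
              Wgrp α (t - t')
                (fun w => Wgrp α t' φ w * deriv (fun a => Wgrp α t' φ (a, w.2)) w.1) z) ≤
          C * HNorm2 s₁ s₂ φ ^ 2 := by
  rintro ⟨T, hT, C, -, H⟩
  set t : ℝ := min T 1 with ht
  have ht0 : 0 < t := lt_min hT one_pos
  set σ : ℝ := Real.sqrt (3 / -α) with hσ
  have hσ2 : σ ^ 2 = 3 / -α := Real.sq_sqrt (div_nonneg (by norm_num) (by linarith))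
  have hσ1 : 1 ≤ σ := by
    rw [hσ, Real.one_le_sqrt, one_le_div (by linarith)]
    linarith
  have hlim : Tendsto (fun N : ℝ => t ^ 2 * (1 / (1000000 * σ)) * N ^ (-α / 2)) atTop atTop :=
    (tendsto_rpow_atTop (by linarith)).const_mul_atTop (by positivity)
  obtain ⟨N, hNlarge, hN⟩ := ((hlim.eventually_gt_atTop
    (9216 * (4 ^ (|s₁| + |s₂|)) ^ 3 * C ^ 2)).and (eventually_ge_atTop (1 : ℝ))).exists
  have hN0 : 0 < N := by linarith
  set r : ℝ := N ^ (1 / 2 : ℝ) with hr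
  set q : ℝ := N ^ ((3 + α) / 2) with hq
  have hr0 : 0 < r := by positivity
  have hq0 : 0 < q := by positivity
  have hr1 : 1 ≤ r := Real.one_le_rpow hN (by norm_num)
  have hrq : r ≤ q := Real.rpow_le_rpow_of_exponent_le hN (by linarith)
  have hr2 : r ^ 2 = N := by
    rw [hr, ← Real.rpow_natCast, ← Real.rpow_mul hN0.le]
    norm_num
  have hrqN : N ^ 2 = r * q * N ^ (-α / 2) := by
    rw [hr, hq, ← Real.rpow_add hN0, ← Real.rpow_add hN0, ← Real.rpow_two]
    congr 1
    ring
  have hαq : N ^ α * N ^ ((3 - α) / 2) = q := by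
    rw [hq, ← Real.rpow_add hN0]
    congr 1
    ring
  have hγ1 : 1 / (1000 * r) ≤ 1 / 1000 := by
    gcongr
    linarith
  have hhγ : 1 / (1000 * (σ * q)) ≤ 1 / (1000 * r) := by
    gcongr
    nlinarith
  refine absurd (le_of_picard_bound (s₁ := s₁) (s₂ := s₂) (C := C) (t := t) (N := N)
    (γ := 1 / (1000 * r)) (h := 1 / (1000 * (σ * q))) (d₀ := σ * N ^ ((3 - α) / 2)) hα1 hα2 hN
    (by positivity) (by linarith) ?_ (by positivity) (by linarith) (by positivity) ?_ ?_ ?_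
    ht0.le (min_le_right _ _) fun φ hφ => H φ hφ t ⟨ht0.le, min_le_left _ _⟩) (not_le.2 ?_)
  · rw [← hr2]
    field_simp
    norm_num
  · have : (N ^ ((3 - α) / 2)) ^ 2 = N ^ (3 - α) := by
      rw [← Real.rpow_natCast, ← Real.rpow_mul hN0.le]
      norm_num
    rw [mul_pow, hσ2, this]
    field_simp [hα2.ne]
  · have : N ^ α * (σ * N ^ ((3 - α) / 2)) = σ * q := by
      rw [← hαq]
      ring
    rw [this]
    apply le_of_eq
    field_simp
  · rw [sq]
    exact mul_le_mul hhγ (hhγ.trans hγ1) (by positivity) (by positivity)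
  · refine hNlarge.trans_eq ?_
    rw [hrqN]
    field_simp
    norm_num
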